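/- Let (Ω^m, F^m, P^m)_{m=1}^∞ be a sequence of probability spaces, each supporting a jointly measurable ℝ^d-valued process X^m and a random partition Π^m = {T_0^m ≤ T_1^m ≤ … ≤ T_{N(m)}^m}, and assume these partitions converge uniformly to the identity. Assume further that the family {X^m} is uniformly integrable with respect to the measures λ_{[0,t]} × P^m for every t ≥ 0. For k = 0, 1, …, N(m) define Y_k^m := ∫_0^{T_k^m} X_u^m du and F_k^m := σ(Y_j^m, T_j^m : 0 ≤ j ≤ k), and assume (Y_k^m, F_k^m)_{0 ≤ k ≤ N(m)} is a martingale for each m. Then lim_{m→∞} E^m sup_{0 ≤ s ≤ t} ‖∫_0^s X_u^m du‖ = 0 for every t ≥ 0. -/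

import Mathlib

open MeasureTheory Filter Set
open scoped ENNReal NNReal Topology

noncomputable section

namespace Mimic

/-- Lebesgue measure on `[0,∞)`, modeled as `ℝ≥0`. -/
def leb : Measure ℝ≥0 := (volume : Measure ℝ).comap (↑·)

set_option linter.unusedSectionVars false

section Core

variable {Ω : Type*} {m0 : MeasurableSpace Ω} {P : Measure Ω} [IsProbabilityMeasure P]

lemma sumBdd {n : ℕ → Ω → ℝ} {c : ℝ} (hb : ∀ k, ∀ᵐ ω ∂P, |n k ω| ≤ c) (K : ℕ) :
    ∀ᵐ ω ∂P, |∑ k ∈ Finset.range K, n k ω| ≤ K * c := by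
  filter_upwards [ae_all_iff.2 hb] with ω h
  calc |∑ k ∈ Finset.range K, n k ω| ≤ ∑ k ∈ Finset.range K, |n k ω| :=
        Finset.abs_sum_le_sum_abs _ _
    _ ≤ ∑ k ∈ Finset.range K, c := Finset.sum_le_sum fun k _ => h k
    _ = K * c := by simp

lemma bddInt {f : Ω → ℝ} {c : ℝ} (hf : AEStronglyMeasurable f P) (hb : ∀ᵐ ω ∂P, |f ω| ≤ c) :
    Integrable f P :=
  Integrable.of_bound hf c (by simpa [Real.norm_eq_abs] using hb)

lemma bddMulInt {f g : Ω → ℝ} {c e : ℝ} (hf : AEStronglyMeasurable f P)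
    (hg : AEStronglyMeasurable g P) (hb : ∀ᵐ ω ∂P, |f ω| ≤ c) (hb' : ∀ᵐ ω ∂P, |g ω| ≤ e) :
    Integrable (fun ω => f ω * g ω) P := by
  refine bddInt (c := c * e) (hf.mul hg) ?_
  filter_upwards [hb, hb'] with ω h1 h2
  rw [abs_mul]
  exact mul_le_mul h1 h2 (abs_nonneg _) ((abs_nonneg _).trans h1)

/-- Kolmogorov maximal inequality for bounded martingale differences. -/
lemma kolmogorov (H : Filtration ℕ m0) (n : ℕ → Ω → ℝ)
    (hm : ∀ k, StronglyMeasurable[H (k + 1)] (n k)) {c : ℝ}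
    (hb : ∀ k, ∀ᵐ ω ∂P, |n k ω| ≤ c)
    (hc : ∀ k, P[n k | H k] =ᵐ[P] 0) (N : ℕ) {l : ℝ} (hl : 0 < l) :
    ∃ B : Set Ω, MeasurableSet B ∧
      P B ≤ ENNReal.ofReal ((∑ k ∈ Finset.range N, ∫ ω, (n k ω) ^ 2 ∂P) / l ^ 2) ∧
      ∀ ω, ω ∉ B → ∀ j ≤ N, |∑ k ∈ Finset.range j, n k ω| ≤ l := by
  set S : ℕ → Ω → ℝ := fun j ω => ∑ k ∈ Finset.range j, n k ω with hS
  have hSm : ∀ j, StronglyMeasurable[H j] (S j) := by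
    intro j
    refine Finset.stronglyMeasurable_fun_sum _ fun k hk => ?_
    exact (hm k).mono (H.mono (by simpa using hk))
  have hSm0 : ∀ j, StronglyMeasurable (S j) := fun j => (hSm j).mono (H.le j)
  have hnm0 : ∀ j, StronglyMeasurable (n j) := fun j => (hm j).mono (H.le _)
  have hSb := fun j => sumBdd hb j
  have hSn : ∀ j, Integrable (fun ω => S j ω * n j ω) P := fun j =>
    bddMulInt (hSm0 j).aestronglyMeasurable (hnm0 j).aestronglyMeasurable (hSb j) (hb j)
  have hnn : ∀ j, Integrable (fun ω => n j ω ^ 2) P := fun j => by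
    simpa [sq] using
    bddMulInt (hnm0 j).aestronglyMeasurable (hnm0 j).aestronglyMeasurable (hb j) (hb j)
  have hSS : ∀ j, Integrable (fun ω => S j ω ^ 2) P := fun j => by
    simpa [sq] using
    bddMulInt (hSm0 j).aestronglyMeasurable (hSm0 j).aestronglyMeasurable (hSb j) (hSb j)
  have hn : ∀ j, Integrable (n j) P := fun j => bddInt (hnm0 j).aestronglyMeasurable (hb j)
  have hce : ∀ j, P[fun ω => S j ω * n j ω | H j] =ᵐ[P] 0 := by
    intro j
    have := condExp_mul_of_stronglyMeasurable_left (μ := P) (hSm j) (g := n j) (hSn j) (hn j)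
    filter_upwards [this, hc j] with ω h1 h2
    have h3 : (S j * n j) = fun ω => S j ω * n j ω := rfl
    rw [h3] at h1
    rw [h1]
    simp [h2]
  have hz : ∀ j, ∫ ω, S j ω * n j ω ∂P = 0 := by
    intro j
    rw [← integral_condExp (H.le j), integral_congr_ae (hce j)]
    simp
  have hstep : ∀ j ω, S (j + 1) ω ^ 2 = S j ω ^ 2 + (2 * (S j ω * n j ω) + n j ω ^ 2) := by
    intro j ω
    simp only [hS, Finset.sum_range_succ]
    ring
  have hE : ∀ j, ∫ ω, S j ω ^ 2 ∂P = ∑ k ∈ Finset.range j, ∫ ω, (n k ω) ^ 2 ∂P := by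
    intro j
    induction j with
    | zero => simp [hS]
    | succ j ih =>
      rw [Finset.sum_range_succ, ← ih]
      simp_rw [hstep]
      have hi : Integrable (fun ω => 2 * (S j ω * n j ω) + n j ω ^ 2) P :=
        ((hSn j).const_mul 2).add (hnn j)
      rw [integral_add (hSS j) hi,
        integral_add ((hSn j).const_mul 2) (hnn j), integral_const_mul, hz]
      simp
  have hsub : Submartingale (fun j ω => S j ω ^ 2) H P := by
    refine submartingale_of_condExp_sub_nonneg_nat (fun j => (hSm j).pow 2) hSS ?_
    intro j
    have h1 : (fun ω => S (j + 1) ω ^ 2) - (fun ω => S j ω ^ 2)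
        = (2 : ℝ) • (fun ω => S j ω * n j ω) + (fun ω => n j ω ^ 2) := by
      ext ω
      simp [hstep]
    rw [h1]
    have h2 := condExp_add (μ := P) (((hSn j).smul (2 : ℝ))) (hnn j) (H j)
    have h3 := condExp_smul (μ := P) (2 : ℝ) (fun ω => S j ω * n j ω) (H j)
    have h4 : 0 ≤ᵐ[P] P[fun ω => n j ω ^ 2 | H j] :=
      condExp_nonneg (Eventually.of_forall fun ω => sq_nonneg _)
    filter_upwards [h2, h3, h4, hce j] with ω g2 g3 g4 g5
    rw [g2, Pi.add_apply, g3, Pi.smul_apply, g5]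
    simpa using g4
  have hmax := maximal_ineq hsub (fun j ω => sq_nonneg _) (ε := (⟨l ^ 2, by positivity⟩ : ℝ≥0)) N
  set B := {ω | ((⟨l ^ 2, by positivity⟩ : ℝ≥0) : ℝ) ≤
    (Finset.range (N + 1)).sup' Finset.nonempty_range_add_one fun k => S k ω ^ 2} with hB
  refine ⟨B, ?_, ?_, ?_⟩
  · refine measurableSet_le measurable_const ?_
    exact Finset.measurable_range_sup'' fun k _ => ((hSm0 k).measurable.pow_const 2)
  · have h1 : ∫ ω in B, S N ω ^ 2 ∂P ≤ ∑ k ∈ Finset.range N, ∫ ω, (n k ω) ^ 2 ∂P := by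
      rw [← hE]
      exact setIntegral_le_integral (hSS N) (Eventually.of_forall fun ω => sq_nonneg _)
    have h2 := hmax.trans (ENNReal.ofReal_le_ofReal h1)
    rw [ENNReal.ofReal_div_of_pos (by positivity)]
    rw [ENNReal.le_div_iff_mul_le (Or.inl (by simpa using hl.ne')) (Or.inl (by simp))]
    rw [mul_comm]
    refine le_trans (le_of_eq ?_) h2
    congr 1
    rw [ENNReal.ofReal]
    congr 1
    exact Real.toNNReal_of_nonneg (by positivity)
  · intro ω hω j hj
    have : ¬ (l ^ 2 ≤ (Finset.range (N + 1)).sup' Finset.nonempty_range_add_one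
      fun k => S k ω ^ 2) := hω
    push Not at this
    have h2 := (Finset.sup'_lt_iff _).1 this j (by simp; omega)
    exact (abs_lt_of_sq_lt_sq h2 hl.le).le

end Core
section Core2

variable {Ω : Type*} {m0 : MeasurableSpace Ω} {P : Measure Ω} [IsProbabilityMeasure P]

lemma core (H : Filtration ℕ m0) (D : ℕ → Ω → ℝ)
    (hDm : ∀ k, StronglyMeasurable[H (k + 1)] (D k)) (hDi : ∀ k, Integrable (D k) P)
    (hD0 : ∀ k, P[D k | H k] =ᵐ[P] 0) (w : ℕ → Ω → ℝ) (hw : ∀ k, Integrable (w k) P)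
    (hw0 : ∀ k ω, 0 ≤ w k ω) {b : ℝ} (hb : 0 ≤ b)
    (hDb : ∀ k, ∀ᵐ ω ∂P, |D k ω| ≤ b + w k ω) (N : ℕ) {ε K : ℝ}
    (hε : ∑ k ∈ Finset.range N, ∫ ω, w k ω ∂P ≤ ε)
    (hK : ∑ k ∈ Finset.range N, ∫ ω, |D k ω| ∂P ≤ K) {l : ℝ} (hl : 0 < l) :
    ∃ (B : Set Ω) (Q : Ω → ℝ≥0∞), MeasurableSet B ∧ Measurable Q ∧
      P B ≤ ENNReal.ofReal (8 * b * K / l ^ 2) ∧ ∫⁻ ω, Q ω ∂P ≤ ENNReal.ofReal (4 * ε) ∧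
      ∀ᵐ ω ∂P, ω ∉ B → ∀ j ≤ N,
        ‖∑ k ∈ Finset.range j, D k ω‖ₑ ≤ ENNReal.ofReal l + Q ω := by
  set U : ℕ → Ω → ℝ := fun k => {ω | |D k ω| ≤ 2 * b}.indicator (D k) with hU
  set R : ℕ → Ω → ℝ := fun k => D k - U k with hR
  set C : ℕ → Ω → ℝ := fun k => P[U k | H k] with hC
  have hUm : ∀ k, StronglyMeasurable[H (k + 1)] (U k) := by
    intro k
    refine (hDm k).indicator ?_
    exact (hDm k).measurable (measurableSet_le measurable_id.abs measurable_const :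
      MeasurableSet {x : ℝ | |x| ≤ 2 * b})
  have hUb : ∀ k ω, |U k ω| ≤ 2 * b := by
    intro k ω
    simp only [hU, indicator]
    split_ifs with h
    · exact h
    · simpa using hb
  have hUD : ∀ k ω, |U k ω| ≤ |D k ω| := by
    intro k ω
    simp only [hU, indicator]
    split_ifs with h
    · exact le_rfl
    · simp
  have hUi : ∀ k, Integrable (U k) P := fun k =>
    bddInt ((hUm k).mono (H.le _)).aestronglyMeasurable (Eventually.of_forall (hUb k))
  have hRi : ∀ k, Integrable (R k) P := fun k => (hDi k).sub (hUi k)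
  have hRw : ∀ k, ∀ᵐ ω ∂P, |R k ω| ≤ 2 * w k ω := by
    intro k
    filter_upwards [hDb k] with ω h
    simp only [hR, hU, Pi.sub_apply, indicator]
    split_ifs with h'
    · simpa using hw0 k ω
    · have : ¬ |D k ω| ≤ 2 * b := h'
      rw [sub_zero]
      linarith
  have hCm : ∀ k, StronglyMeasurable[H k] (C k) := fun k => stronglyMeasurable_condExp
  have hCi : ∀ k, Integrable (C k) P := fun k => integrable_condExp
  have hCb : ∀ k, ∀ᵐ ω ∂P, |C k ω| ≤ 2 * b := fun k =>
    ae_bdd_abs_condExp_of_ae_bdd_abs (Eventually.of_forall (hUb k))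
  have hCU : ∀ k, ∫ ω, |C k ω| ∂P ≤ ∫ ω, |D k ω| ∂P := fun k =>
    (integral_abs_condExp_le (U k)).trans
      (integral_mono (hUi k).abs (hDi k).abs (hUD k))
  have hCR : ∀ k, ∫ ω, |C k ω| ∂P ≤ ∫ ω, |R k ω| ∂P := by
    intro k
    have h1 : C k =ᵐ[P] - P[R k | H k] := by
      have h2 := condExp_sub (μ := P) (hDi k) (hUi k) (H k)
      filter_upwards [h2, hD0 k] with ω g1 g2
      simp only [hR, Pi.neg_apply]
      rw [g1, Pi.sub_apply, g2]
      simp [hC]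
    calc ∫ ω, |C k ω| ∂P = ∫ ω, |P[R k | H k] ω| ∂P := by
          refine integral_congr_ae ?_
          filter_upwards [h1] with ω g
          simp [g]
      _ ≤ _ := integral_abs_condExp_le (R k)
  have hRε : ∀ k, ∫ ω, |R k ω| ∂P ≤ 2 * ∫ ω, w k ω ∂P := by
    intro k
    rw [← integral_const_mul]
    exact integral_mono_ae (hRi k).abs ((hw k).const_mul 2) (hRw k)
  set n : ℕ → Ω → ℝ := fun k => U k - C k with hn
  have hnm : ∀ k, StronglyMeasurable[H (k + 1)] (n k) := fun k =>
    (hUm k).sub ((hCm k).mono (H.mono (Nat.le_succ k)))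
  have hni : ∀ k, Integrable (n k) P := fun k => (hUi k).sub (hCi k)
  have hnb : ∀ k, ∀ᵐ ω ∂P, |n k ω| ≤ 4 * b := by
    intro k
    filter_upwards [hCb k] with ω h
    have h2 := hUb k ω
    have := abs_sub (U k ω) (C k ω)
    simp only [hn, Pi.sub_apply]
    linarith
  have hn0 : ∀ k, P[n k | H k] =ᵐ[P] 0 := by
    intro k
    have h2 := condExp_sub (μ := P) (hUi k) (hCi k) (H k)
    filter_upwards [h2] with ω g
    simp only [hn]
    rw [g, Pi.sub_apply, condExp_of_stronglyMeasurable (H.le k) (hCm k) (hCi k)]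
    simp [hC]
  have hnn : ∀ k, ∫ ω, n k ω ^ 2 ∂P ≤ 8 * b * ∫ ω, |D k ω| ∂P := by
    intro k
    calc ∫ ω, n k ω ^ 2 ∂P ≤ ∫ ω, 4 * b * (|D k ω| + |C k ω|) ∂P := by
          refine integral_mono_of_nonneg (Eventually.of_forall fun ω => sq_nonneg _)
            (((hDi k).abs.add (hCi k).abs).const_mul _) ?_
          filter_upwards [hnb k] with ω h
          have h1 : |n k ω| ≤ |D k ω| + |C k ω| :=
            (abs_sub (U k ω) (C k ω)).trans (by have := hUD k ω; linarith)
          show n k ω ^ 2 ≤ 4 * b * (|D k ω| + |C k ω|)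
          rw [← sq_abs, sq]
          exact mul_le_mul h h1 (abs_nonneg _) (by positivity)
      _ = 4 * b * (∫ ω, |D k ω| ∂P + ∫ ω, |C k ω| ∂P) := by
          rw [integral_const_mul, integral_add (hDi k).abs (hCi k).abs]
      _ ≤ 4 * b * (∫ ω, |D k ω| ∂P + ∫ ω, |D k ω| ∂P) := by
          have := hCU k
          gcongr
      _ = _ := by ring
  obtain ⟨B, hB, hPB, hBS⟩ := kolmogorov H n hnm hnb hn0 N hl
  set q : Ω → ℝ := fun ω => ∑ k ∈ Finset.range N, (|R k ω| + |C k ω|) with hq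
  have hqi : Integrable q P := integrable_finsetSum _ fun k _ => (hRi k).abs.add (hCi k).abs
  have hqm : Measurable q := by
    refine Finset.measurable_fun_sum _ fun k _ => ?_
    have h1 : Measurable (U k) := ((hUm k).mono (H.le _)).measurable
    have h2 : Measurable (D k) := ((hDm k).mono (H.le _)).measurable
    have h3 : Measurable (C k) := ((hCm k).mono (H.le _)).measurable
    exact (h2.sub h1).abs.add h3.abs
  refine ⟨B, fun ω => ENNReal.ofReal (q ω), hB, hqm.ennreal_ofReal, ?_, ?_, ?_⟩
  · refine hPB.trans (ENNReal.ofReal_le_ofReal ?_)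
    gcongr
    calc ∑ k ∈ Finset.range N, ∫ ω, n k ω ^ 2 ∂P
        ≤ ∑ k ∈ Finset.range N, 8 * b * ∫ ω, |D k ω| ∂P := Finset.sum_le_sum fun k _ => hnn k
      _ = 8 * b * ∑ k ∈ Finset.range N, ∫ ω, |D k ω| ∂P := by rw [Finset.mul_sum]
      _ ≤ 8 * b * K := by gcongr
  · rw [← ofReal_integral_eq_lintegral_ofReal hqi (Eventually.of_forall fun ω =>
      Finset.sum_nonneg fun k _ => by positivity)]
    refine ENNReal.ofReal_le_ofReal ?_
    have hRC : ∀ k, Integrable (fun ω => |R k ω| + |C k ω|) P := fun k =>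
      (hRi k).abs.add (hCi k).abs
    simp only [hq]
    rw [integral_finsetSum _ fun k _ => hRC k]
    calc ∑ k ∈ Finset.range N, ∫ ω, (|R k ω| + |C k ω|) ∂P
        ≤ ∑ k ∈ Finset.range N, 4 * ∫ ω, w k ω ∂P := by
          refine Finset.sum_le_sum fun k _ => ?_
          rw [integral_add (hRi k).abs (hCi k).abs]
          have h1 := hCR k
          have h2 := hRε k
          linarith
      _ = 4 * ∑ k ∈ Finset.range N, ∫ ω, w k ω ∂P := by rw [Finset.mul_sum]
      _ ≤ 4 * ε := by gcongr
  · refine Eventually.of_forall fun ω hω j hj => ?_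
    rw [Real.enorm_eq_ofReal_abs, ← ENNReal.ofReal_add hl.le
      (Finset.sum_nonneg fun k _ => by positivity)]
    refine ENNReal.ofReal_le_ofReal ?_
    have h1 : ∑ k ∈ Finset.range j, D k ω = ∑ k ∈ Finset.range j, n k ω +
        ∑ k ∈ Finset.range j, (R k ω + C k ω) := by
      rw [← Finset.sum_add_distrib]
      refine Finset.sum_congr rfl fun k _ => ?_
      simp only [hn, hR, Pi.sub_apply]
      ring
    rw [h1]
    refine (abs_add_le _ _).trans (add_le_add (hBS ω hω j hj) ?_)
    calc |∑ k ∈ Finset.range j, (R k ω + C k ω)|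
        ≤ ∑ k ∈ Finset.range j, |R k ω + C k ω| := Finset.abs_sum_le_sum_abs _ _
      _ ≤ ∑ k ∈ Finset.range j, (|R k ω| + |C k ω|) :=
          Finset.sum_le_sum fun k _ => abs_add_le _ _
      _ ≤ q ω := Finset.sum_le_sum_of_subset_of_nonneg
          (by intro i; simp; omega) fun k _ _ => by positivity

end Core2
section Hull

variable {Ω : Type*} {F : MeasurableSpace Ω} {m0 : MeasurableSpace Ω} {P : Measure Ω} [IsProbabilityMeasure P]

/-- `C` is a measurable hull of the (possibly non-measurable) set `A`. -/
def IsHull (P : Measure Ω) (A C : Set Ω) : Prop :=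
  MeasurableSet C ∧ (∀ᵐ ω ∂P, ω ∈ A → ω ∈ C) ∧
    ∀ E, MeasurableSet E → (∀ᵐ ω ∂P, ω ∈ A → ω ∈ E) → ∀ᵐ ω ∂P, ω ∈ C → ω ∈ E

lemma isHull_toMeasurable (A : Set Ω) : IsHull P A (toMeasurable P A) := by
  refine ⟨measurableSet_toMeasurable _ _,
    Eventually.of_forall fun ω h => subset_toMeasurable _ _ h, fun E hE h => ?_⟩
  have h1 := Measure.measure_toMeasurable_inter (μ := P) hE.compl (measure_ne_top P A)
  have h2 : P (A ∩ Eᶜ) = 0 := by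
    rw [← h]
    congr 1
    ext ω
    simp
  rw [h2] at h1
  rw [ae_iff, ← h1]
  congr 1
  ext ω
  simp

lemma IsHull.union {A B C D : Set Ω} (h : IsHull P A C) (h' : IsHull P B D) :
    IsHull P (A ∪ B) (C ∪ D) := by
  refine ⟨h.1.union h'.1, ?_, fun E hE hAE => ?_⟩
  · filter_upwards [h.2.1, h'.2.1] with ω h1 h2
    rintro (h | h)
    · exact Or.inl (h1 h)
    · exact Or.inr (h2 h)
  · filter_upwards [h.2.2 E hE (by filter_upwards [hAE] with ω h1 h2 using h1 (Or.inl h2)),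
      h'.2.2 E hE (by filter_upwards [hAE] with ω h1 h2 using h1 (Or.inr h2))] with ω h1 h2
    rintro (h | h)
    · exact h1 h
    · exact h2 h

lemma IsHull.of_ae_eq {A C : Set Ω} (hC : MeasurableSet C) (h : A =ᵐ[P] C) : IsHull P A C := by
  have h' : ∀ᵐ ω ∂P, ω ∈ A ↔ ω ∈ C := by
    filter_upwards [h] with ω h1
    exact Iff.of_eq h1
  refine ⟨hC, ?_, fun E hE hAE => ?_⟩
  · filter_upwards [h'] with ω h1 using h1.1
  · filter_upwards [h', hAE] with ω h1 h2 h3 using h2 (h1.2 h3)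

variable {E : Type*} [NormedAddCommGroup E] [NormedSpace ℝ E]

lemma IsHull.setIntegral {A C : Set Ω} (h : IsHull P A C) (f : Ω → E) :
    ∫ ω in C, f ω ∂P = ∫ ω in A, f ω ∂P := by
  rw [← Measure.restrict_toMeasurable (measure_ne_top P A)]
  have h' := isHull_toMeasurable (P := P) A
  have : C =ᵐ[P] toMeasurable P A := by
    filter_upwards [h.2.2 _ h'.1 h'.2.1, h'.2.2 _ h.1 h.2.1] with ω h1 h2
    exact propext ⟨h1, h2⟩
  rw [Measure.restrict_congr_set this]

/-- the class of measurable hulls of sets of a σ-algebra. -/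
def hullGen (P : Measure Ω) (F : MeasurableSpace Ω) : Set (Set Ω) :=
  {C | ∃ A, MeasurableSet[F] A ∧ IsHull P A C}

/-- the σ-algebra generated by the measurable hulls. -/
@[reducible] def hullSigma (P : Measure Ω) (F : MeasurableSpace Ω) : MeasurableSpace Ω :=
  MeasurableSpace.generateFrom (hullGen P F)

lemma hullSigma_le (F : MeasurableSpace Ω) : hullSigma P F ≤ m0 :=
  MeasurableSpace.generateFrom_le fun _ ⟨_, _, h⟩ => h.1

lemma hullSigma_mono {F G : MeasurableSpace Ω} (h : F ≤ G) : hullSigma P F ≤ hullSigma P G :=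
  MeasurableSpace.generateFrom_mono fun _ ⟨A, hA, hC⟩ => ⟨A, h _ hA, hC⟩

lemma hullGen_union {C D : Set Ω} (hC : C ∈ hullGen P F)
    (hD : D ∈ hullGen P F) : C ∪ D ∈ hullGen P F := by
  obtain ⟨A, hA, h⟩ := hC
  obtain ⟨B, hB, h'⟩ := hD
  exact ⟨A ∪ B, hA.union hB, h.union h'⟩

/-- intersection of a list of sets -/
def interList (l : List (Set Ω)) : Set Ω := l.foldr (· ∩ ·) univ

lemma interList_append (l l' : List (Set Ω)) :
    interList (l ++ l') = interList l ∩ interList l' := by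
  induction l with
  | nil => simp [interList]
  | cons a l ih =>
    simp only [interList, List.cons_append, List.foldr_cons] at ih ⊢
    rw [ih, inter_assoc]

lemma interList_union (l : List (Set Ω)) (g : Set Ω) :
    interList (l.map (· ∪ g)) = interList l ∪ g := by
  induction l with
  | nil => simp [interList]
  | cons a l ih =>
    simp only [interList, List.map_cons, List.foldr_cons] at ih ⊢
    rw [ih, ← inter_union_distrib_right]

lemma interList_meas (l : List (Set Ω)) (h : ∀ c ∈ l, MeasurableSet c) :
    MeasurableSet (interList l) := by
  induction l with
  | nil => simp [interList]
  | cons a l ih =>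
    simp only [interList, List.foldr_cons] at ih ⊢
    exact (h a (by simp)).inter (ih fun c hc => h c (by simp [hc]))

lemma interList_integral {f : Ω → E} (hf : Integrable f P)
    (h0 : ∀ A, MeasurableSet[F] A → ∫ ω in A, f ω ∂P = 0) (n : ℕ) :
    ∀ l : List (Set Ω), l.length = n → (∀ c ∈ l, c ∈ hullGen P F) →
      ∫ ω in interList l, f ω ∂P = 0 := by
  have hg : ∀ g ∈ hullGen P F, ∫ ω in g, f ω ∂P = 0 := by
    rintro g ⟨A, hA, h⟩
    rw [h.setIntegral, h0 A hA]
  induction n with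
  | zero =>
    intro l hl _
    rw [List.length_eq_zero_iff.1 hl]
    simpa [interList] using h0 univ MeasurableSet.univ
  | succ n ih =>
    intro l hl hc
    match l with
    | [] => simp at hl
    | a :: l =>
      have hl' : l.length = n := by simpa using hl
      have ha := hc a (by simp)
      have hc' : ∀ c ∈ l, c ∈ hullGen P F := fun c h => hc c (by simp [h])
      have h1 := ih l hl' hc'
      have h2 := ih (l.map (· ∪ a)) (by simpa using hl') (by
        intro c hc
        obtain ⟨c', h, rfl⟩ := List.mem_map.1 hc
        exact hullGen_union (hc' c' h) ha)
      rw [interList_union] at h2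
      have hm : MeasurableSet (interList l) := interList_meas l fun c h => by
        obtain ⟨_, _, h⟩ := hc' c h
        exact h.1
      have ham : MeasurableSet a := by
        obtain ⟨_, _, h⟩ := ha
        exact h.1
      have h3 : ∫ ω in interList l ∪ a, f ω ∂P + ∫ ω in interList l ∩ a, f ω ∂P
          = ∫ ω in interList l, f ω ∂P + ∫ ω in a, f ω ∂P := by
        rw [← integral_add_measure hf.restrict hf.restrict,
          ← integral_add_measure hf.restrict hf.restrict, Measure.restrict_union_add_inter _ ham]
      rw [h2, h1, hg a ha] at h3
      have : interList (a :: l) = interList l ∩ a := by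
        rw [inter_comm]
        rfl
      rw [this]
      simpa using h3

lemma hullSigma_integral {f : Ω → E} (hf : Integrable f P)
    (h0 : ∀ A, MeasurableSet[F] A → ∫ ω in A, f ω ∂P = 0) (C : Set Ω)
    (hC : MeasurableSet[hullSigma P F] C) : ∫ ω in C, f ω ∂P = 0 := by
  set S : Set (Set Ω) := {C | ∃ l : List (Set Ω), (∀ c ∈ l, c ∈ hullGen P F) ∧ C = interList l}
    with hS
  have hpi : IsPiSystem S := by
    rintro _ ⟨l, hl, rfl⟩ _ ⟨l', hl', rfl⟩ _
    refine ⟨l ++ l', ?_, (interList_append l l').symm⟩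
    intro c hc
    rcases List.mem_append.1 hc with h | h
    · exact hl c h
    · exact hl' c h
  have hSm : ∀ s ∈ S, MeasurableSet s := by
    rintro _ ⟨l, hl, rfl⟩
    refine interList_meas l fun c h => ?_
    obtain ⟨_, _, h⟩ := hl c h
    exact h.1
  have hle : hullSigma P F ≤ MeasurableSpace.generateFrom S := by
    refine MeasurableSpace.generateFrom_mono fun c hc => ⟨[c], by simpa using hc, ?_⟩
    simp [interList]
  have hSle : MeasurableSpace.generateFrom S ≤ m0 := MeasurableSpace.generateFrom_le hSm
  have huniv : ∫ ω, f ω ∂P = 0 := by simpa using h0 univ MeasurableSet.univ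
  have hC' := hle _ hC
  refine MeasurableSpace.induction_on_inter (m := MeasurableSpace.generateFrom S)
    (C := fun C _ => ∫ ω in C, f ω ∂P = 0) rfl hpi ?_ ?_ ?_ ?_ C hC'
  · simp
  · rintro _ ⟨l, hl, rfl⟩
    exact interList_integral hf h0 _ l rfl hl
  · intro t ht h
    have := integral_add_compl (hSle _ ht) hf
    rw [h, huniv] at this
    simpa using this
  · intro g hd hm h
    rw [integral_iUnion (fun i => hSle _ (hm i)) hd hf.integrableOn]
    simp [h]

lemma hullSigma_measurable {β : Type*} [MeasurableSpace β]
    {y y' : Ω → β} (hy : Measurable[F] y) (hy' : Measurable y') (h : y =ᵐ[P] y') :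
    Measurable[hullSigma P F] y' := by
  intro B hB
  refine MeasurableSpace.measurableSet_generateFrom ⟨y ⁻¹' B, hy hB, ?_⟩
  refine IsHull.of_ae_eq (hy' hB) ?_
  filter_upwards [h] with ω hω
  show (y ω ∈ B) = (y' ω ∈ B)
  rw [hω]

open scoped Classical in
/-- lower measurable envelope of a (possibly non-measurable) function -/
def env (P : Measure Ω) (T : Ω → ℝ≥0) (ω : Ω) : ℝ≥0∞ :=
  ⨅ q : ℚ, (toMeasurable P {ω | T ω < Real.toNNReal q}).piecewise
    (fun _ => ((Real.toNNReal q : ℝ≥0) : ℝ≥0∞)) (fun _ => ⊤) ω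

lemma env_le (T : Ω → ℝ≥0) (ω : Ω) : env P T ω ≤ T ω := by
  refine le_of_forall_gt fun c hc => ?_
  obtain ⟨q, _, h1, h2⟩ := ENNReal.lt_iff_exists_rat_btwn.1 hc
  refine lt_of_le_of_lt (iInf_le _ q) ?_
  rw [piecewise_eq_of_mem]
  · exact h2
  · apply subset_toMeasurable
    exact_mod_cast h1

lemma le_env (T : Ω → ℝ≥0) {g : Ω → ℝ≥0∞} (hg : Measurable g) (h : ∀ᵐ ω ∂P, g ω ≤ T ω) :
    ∀ᵐ ω ∂P, g ω ≤ env P T ω := by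
  classical
  have : ∀ q : ℚ, ∀ᵐ ω ∂P, ω ∈ toMeasurable P {ω | T ω < Real.toNNReal q} →
      ω ∈ {ω | g ω < (Real.toNNReal q : ℝ≥0)} := by
    intro q
    refine (isHull_toMeasurable _).2.2 _ (measurableSet_lt hg measurable_const) ?_
    filter_upwards [h] with ω h1 h2
    refine lt_of_le_of_lt h1 ?_
    exact_mod_cast h2
  filter_upwards [ae_all_iff.2 this] with ω hω
  refine le_iInf fun q => ?_
  by_cases hq : ω ∈ toMeasurable P {ω | T ω < Real.toNNReal q}
  · rw [piecewise_eq_of_mem _ _ _ hq]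
    exact (hω q hq).le
  · rw [piecewise_eq_of_notMem _ _ _ hq]
    exact le_top

lemma env_measurable {T : Ω → ℝ≥0} (hT : Measurable[F] T) :
    Measurable[hullSigma P F] (env P T) := by
  refine Measurable.iInf fun q => ?_
  refine Measurable.piecewise ?_ measurable_const measurable_const
  exact MeasurableSpace.measurableSet_generateFrom
    ⟨_, hT (measurableSet_Iio : MeasurableSet (Iio (Real.toNNReal q))), isHull_toMeasurable _⟩

end Hull
section Leb

lemma leb_emb : MeasurableEmbedding ((↑·) : ℝ≥0 → ℝ) :=
  MeasurableEmbedding.subtype_coe measurableSet_Ici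

lemma leb_apply (s : Set ℝ≥0) : leb s = volume (Set.image ((↑·) : ℝ≥0 → ℝ) s) :=
  leb_emb.comap_apply _ _

lemma leb_Iic (s : ℝ≥0) : leb (Iic s) = s := by
  rw [leb_apply]
  have : Set.image ((↑·) : ℝ≥0 → ℝ) (Iic s) = Icc 0 (s : ℝ) := by
    ext x
    constructor
    · rintro ⟨y, hy, rfl⟩
      exact ⟨y.2, by exact_mod_cast hy⟩
    · rintro ⟨h0, h1⟩
      exact ⟨⟨x, h0⟩, by exact_mod_cast h1, rfl⟩
  rw [this]
  simp

lemma leb_Ioc (a b : ℝ≥0) : leb (Ioc a b) = ((b - a : ℝ≥0) : ℝ≥0∞) := by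
  rw [leb_apply]
  have : Set.image ((↑·) : ℝ≥0 → ℝ) (Ioc a b) = Ioc (a : ℝ) (b : ℝ) := by
    ext x
    constructor
    · rintro ⟨y, hy, rfl⟩
      exact ⟨by exact_mod_cast hy.1, by exact_mod_cast hy.2⟩
    · rintro ⟨h0, h1⟩
      exact ⟨⟨x, a.2.trans h0.le⟩, ⟨by exact_mod_cast h0, by exact_mod_cast h1⟩, rfl⟩
  rw [this, Real.volume_Ioc, ENNReal.ofReal]
  congr 1

instance : SFinite leb := by
  have : SigmaFinite leb := ⟨⟨{
    set := fun n => Iic (n : ℝ≥0)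
    set_mem := fun _ => trivial
    finite := fun n => by rw [leb_Iic]; exact ENNReal.coe_lt_top
    spanning := by
      ext x
      simp only [mem_iUnion, mem_Iic, mem_univ, iff_true]
      exact exists_nat_ge x }⟩⟩
  infer_instance

end Leb

section Env

variable {Ω : Type*} {F : MeasurableSpace Ω} {m0 : MeasurableSpace Ω} {P : Measure Ω}
  [IsProbabilityMeasure P]

/-- `ℝ≥0`-valued version of `env`. -/
def envN (P : Measure Ω) (T : Ω → ℝ≥0) (ω : Ω) : ℝ≥0 := (env P T ω).toNNReal

lemma coe_envN (T : Ω → ℝ≥0) (ω : Ω) : (envN P T ω : ℝ≥0∞) = env P T ω :=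
  ENNReal.coe_toNNReal (ne_top_of_le_ne_top ENNReal.coe_ne_top (env_le T ω))

lemma envN_le (T : Ω → ℝ≥0) (ω : Ω) : envN P T ω ≤ T ω := by
  have := env_le (P := P) T ω
  rw [← coe_envN] at this
  exact_mod_cast this

lemma le_envN (T : Ω → ℝ≥0) {g : Ω → ℝ≥0} (hg : Measurable g) (h : ∀ᵐ ω ∂P, g ω ≤ T ω) :
    ∀ᵐ ω ∂P, g ω ≤ envN P T ω := by
  have := le_env (P := P) T (g := fun ω => (g ω : ℝ≥0∞)) hg.coe_nnreal_ennreal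
    (by filter_upwards [h] with ω hω; exact_mod_cast hω)
  filter_upwards [this] with ω hω
  rw [← coe_envN] at hω
  exact_mod_cast hω

lemma envN_measurable' {T : Ω → ℝ≥0} (hT : Measurable[F] T) :
    Measurable[hullSigma P F] (envN P T) :=
  (env_measurable hT).ennreal_toNNReal

lemma envN_measurable (T : Ω → ℝ≥0) : Measurable (envN P T) :=
  (envN_measurable' (F := ⊤) (P := P) (T := T) measurable_from_top).mono (hullSigma_le _) le_rfl

variable {E : Type*} [NormedAddCommGroup E] [NormedSpace ℝ E] [CompleteSpace E]
  [MeasurableSpace E] [BorelSpace E] [SecondCountableTopology E]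

lemma measLin {f : ℝ≥0 → Ω → ℝ≥0∞} (hf : Measurable (Function.uncurry f)) {s s' : Ω → ℝ≥0}
    (hs : Measurable s) (hs' : Measurable s') :
    Measurable fun ω => ∫⁻ u in Ioc (s ω) (s' ω), f u ω ∂leb := by
  have hset : MeasurableSet ({p : ℝ≥0 × Ω | s p.2 < p.1} ∩ {p : ℝ≥0 × Ω | p.1 ≤ s' p.2}) :=
    (measurableSet_lt (hs.comp measurable_snd) measurable_fst).inter
      (measurableSet_le measurable_fst (hs'.comp measurable_snd))
  have := (hf.indicator hset).lintegral_prod_left' (μ := leb)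
  convert this using 2 with ω
  rw [← lintegral_indicator measurableSet_Ioc]
  rfl

lemma measLinIic {f : ℝ≥0 → Ω → ℝ≥0∞} (hf : Measurable (Function.uncurry f)) {s : Ω → ℝ≥0}
    (hs : Measurable s) :
    Measurable fun ω => ∫⁻ u in Iic (s ω), f u ω ∂leb := by
  have hset : MeasurableSet {p : ℝ≥0 × Ω | p.1 ∈ Iic (s p.2)} :=
    (measurableSet_le measurable_fst (hs.comp measurable_snd))
  have := (hf.indicator hset).lintegral_prod_left' (μ := leb)
  convert this using 2 with ω
  rw [← lintegral_indicator measurableSet_Iic]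
  rfl

lemma measInt {x : ℝ≥0 → Ω → E} (hx : Measurable (Function.uncurry x)) {s : Ω → ℝ≥0}
    (hs : Measurable s) :
    StronglyMeasurable fun ω => ∫ u in Iic (s ω), x u ω ∂leb := by
  have hset : MeasurableSet {p : ℝ≥0 × Ω | p.1 ∈ Iic (s p.2)} :=
    (measurableSet_le measurable_fst (hs.comp measurable_snd))
  have := (hx.indicator hset).stronglyMeasurable.integral_prod_left' (μ := leb)
  convert this using 2 with ω
  rw [← integral_indicator measurableSet_Iic]
  rfl

lemma incr_le {f : ℝ≥0 → E} (hf : Measurable f) {a b : ℝ≥0} (hab : a ≤ b)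
    (hfin : ∫⁻ u in Iic b, ‖f u‖ₑ ∂leb < ⊤) :
    ‖(∫ u in Iic b, f u ∂leb) - ∫ u in Iic a, f u ∂leb‖ₑ ≤ ∫⁻ u in Ioc a b, ‖f u‖ₑ ∂leb := by
  have hi : IntegrableOn f (Iic b) leb := ⟨hf.aestronglyMeasurable, hfin⟩
  have h1 := setIntegral_union (μ := leb) (f := f) (s := Iic a) (t := Ioc a b)
    (Iic_disjoint_Ioc le_rfl) measurableSet_Ioc (hi.mono_set (Iic_subset_Iic.2 hab))
    (hi.mono_set Ioc_subset_Iic_self)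
  rw [Iic_union_Ioc_eq_Iic hab] at h1
  rw [h1, add_sub_cancel_left]
  exact enorm_integral_le_lintegral_enorm _

lemma transfer {x : ℝ≥0 → Ω → E} (hx : Measurable (Function.uncurry x))
    (hfin : ∀ᵐ ω ∂P, ∀ t : ℝ≥0, ∫⁻ u in Iic t, ‖x u ω‖ₑ ∂leb < ⊤) (T : Ω → ℝ≥0)
    (hY : AEStronglyMeasurable (fun ω => ∫ u in Iic (T ω), x u ω ∂leb) P) :
    ∀ᵐ ω ∂P, ∫ u in Iic (envN P T ω), x u ω ∂leb = ∫ u in Iic (T ω), x u ω ∂leb := by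
  set s := envN P T with hs
  have hsm : Measurable s := envN_measurable T
  set y := hY.mk _ with hy
  have hym : StronglyMeasurable y := hY.stronglyMeasurable_mk
  have hyeq := hY.ae_eq_mk
  have hxe : Measurable (Function.uncurry fun u ω => ‖x u ω‖ₑ) := hx.enorm
  have hxω : ∀ ω, Measurable fun u => x u ω := fun ω => hx.comp measurable_prodMk_right
  set r : ℕ → ℝ≥0 := fun n => 1 / ((n : ℝ≥0) + 1) with hr
  have hrpos : ∀ n, 0 < r n := fun n => by positivity
  set B : ℕ → Set Ω := fun n => {ω | ∫⁻ u in Ioc (s ω) (s ω + r n), ‖x u ω‖ₑ ∂leb <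
    ‖y ω - ∫ u in Iic (s ω), x u ω ∂leb‖ₑ} with hB
  have hBm : ∀ n, MeasurableSet (B n) := fun n =>
    measurableSet_lt (measLin hxe hsm (hsm.add_const _))
      (hym.sub (measInt hx hsm)).enorm
  have hBn : ∀ n, ∀ᵐ ω ∂P, ω ∉ B n := by
    intro n
    have hg : Measurable fun ω => s ω + (B n).indicator (fun _ => r n) ω :=
      hsm.add (measurable_const.indicator (hBm n))
    have hgT : ∀ᵐ ω ∂P, s ω + (B n).indicator (fun _ => r n) ω ≤ T ω := by
      filter_upwards [hfin, hyeq] with ω h1 h2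
      by_cases hω : ω ∈ B n
      · rw [indicator_of_mem hω]
        by_contra! hlt
        have h3 := incr_le (hxω ω) (envN_le (P := P) T ω) (h1 _)
        rw [h2] at h3
        have h4 : ∫⁻ u in Ioc (s ω) (T ω), ‖x u ω‖ₑ ∂leb ≤
            ∫⁻ u in Ioc (s ω) (s ω + r n), ‖x u ω‖ₑ ∂leb :=
          lintegral_mono_set (Ioc_subset_Ioc_right hlt.le)
        exact absurd (h3.trans h4) (not_le.2 hω)
      · rw [indicator_of_notMem hω, add_zero]
        exact envN_le T ω
    filter_upwards [le_envN T hg hgT] with ω h1 hω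
    rw [indicator_of_mem hω] at h1
    exact absurd h1 (not_le.2 (lt_add_of_pos_right _ (hrpos n)))
  filter_upwards [ae_all_iff.2 hBn, hfin, hyeq] with ω h1 h2 h3
  rw [h3]
  have h4 : ∀ n, ‖y ω - ∫ u in Iic (s ω), x u ω ∂leb‖ₑ ≤
      ∫⁻ u in Ioc (s ω) (s ω + r n), ‖x u ω‖ₑ ∂leb := fun n => not_lt.1 (h1 n)
  have hr0 : Tendsto r atTop (𝓝 0) := tendsto_one_div_add_atTop_nhds_zero_nat
  have h5 : Tendsto (fun n => ∫⁻ u in Ioc (s ω) (s ω + r n), ‖x u ω‖ₑ ∂leb) atTop (𝓝 0) := by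
    have h6 : Tendsto (fun n => ∫⁻ u in Ioc (s ω) (s ω + r n), ‖x u ω‖ₑ
        ∂(leb.restrict (Iic (s ω + 1)))) atTop (𝓝 0) := by
      refine tendsto_setLIntegral_zero (h2 _).ne ?_
      refine tendsto_of_tendsto_of_tendsto_of_le_of_le (h := fun n => (r n : ℝ≥0∞))
        tendsto_const_nhds (by simpa using ENNReal.tendsto_coe.2 hr0) (fun _ => zero_le) ?_
      intro n
      refine (Measure.restrict_apply_le _ _).trans ?_
      rw [leb_Ioc, add_tsub_cancel_left]
    refine h6.congr fun n => ?_
    rw [Measure.restrict_restrict measurableSet_Ioc, inter_eq_left.2]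
    refine fun u hu => hu.2.trans ?_
    gcongr
    simp only [hr]
    rw [div_le_one (by positivity)]
    simp
  have h7 := ge_of_tendsto' h5 h4
  have h8 : y ω - ∫ u in Iic (s ω), x u ω ∂leb = 0 := by simpa using h7
  exact (sub_eq_zero.1 h8).symm

end Env
section Quant

lemma sum_toReal_le (g : ℕ → ℝ≥0∞) (N : ℕ) {c : ℝ} (hc : 0 ≤ c)
    (h : ∑ k ∈ Finset.range N, g k ≤ ENNReal.ofReal c) :
    ∑ k ∈ Finset.range N, (g k).toReal ≤ c := by
  have hne : ∑ k ∈ Finset.range N, g k ≠ ⊤ := ne_top_of_le_ne_top ENNReal.ofReal_ne_top h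
  rw [← ENNReal.toReal_sum (fun k hk => (ENNReal.sum_ne_top.1 hne k hk))]
  exact ENNReal.toReal_le_of_le_ofReal hc h

lemma telescope (f : ℝ≥0 → ℝ≥0∞) (p : ℕ → ℝ≥0) (N : ℕ) (hp : ∀ k < N, p k ≤ p (k + 1)) :
    ∑ k ∈ Finset.range N, ∫⁻ u in Ioc (p k) (p (k + 1)), f u ∂leb ≤
      ∫⁻ u in Iic (p N), f u ∂leb := by
  induction N with
  | zero => simp
  | succ n ih =>
    rw [Finset.sum_range_succ, ← Iic_union_Ioc_eq_Iic (hp n (Nat.lt_succ_self n)),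
      lintegral_union measurableSet_Ioc (Iic_disjoint_Ioc le_rfl)]
    gcongr
    exact ih fun k hk => hp k (hk.trans (Nat.lt_succ_self n))

lemma enorm_le_sum {d : ℕ} (v : EuclideanSpace ℝ (Fin d)) : ‖v‖ₑ ≤ ∑ i, ‖v i‖ₑ := by
  have h : ‖v‖ ≤ ∑ i, ‖v i‖ := by
    rw [EuclideanSpace.norm_eq]
    refine Real.sqrt_le_iff.2 ⟨Finset.sum_nonneg fun i _ => norm_nonneg _, ?_⟩
    exact Finset.sum_sq_le_sq_sum_of_nonneg fun i _ => norm_nonneg _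
  have h2 := ENNReal.ofReal_le_ofReal h
  rw [ENNReal.ofReal_sum_of_nonneg fun i _ => norm_nonneg _] at h2
  simpa only [ofReal_norm] using h2

variable {Ω : Type*} {m0 : MeasurableSpace Ω} {P : Measure Ω} [IsProbabilityMeasure P] {d : ℕ}

/-- the truncated tail of the process -/
def tail (x : ℝ≥0 → Ω → EuclideanSpace ℝ (Fin d)) (M : ℝ≥0) (u : ℝ≥0) (ω : Ω) : ℝ≥0∞ :=
  if (M : ℝ) ≤ ‖x u ω‖ then ‖x u ω‖ₑ else 0

lemma tail_meas {x : ℝ≥0 → Ω → EuclideanSpace ℝ (Fin d)}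
    (hx : Measurable (Function.uncurry x)) (M : ℝ≥0) :
    Measurable (Function.uncurry (tail x M)) :=
  Measurable.ite (measurableSet_le measurable_const hx.norm) hx.enorm measurable_const

lemma tail_bound (x : ℝ≥0 → Ω → EuclideanSpace ℝ (Fin d)) (M : ℝ≥0) (ω : Ω) (S : Set ℝ≥0) :
    ∫⁻ u in S, ‖x u ω‖ₑ ∂leb ≤ M * leb S + ∫⁻ u in S, tail x M u ω ∂leb := by
  calc ∫⁻ u in S, ‖x u ω‖ₑ ∂leb ≤ ∫⁻ u in S, ((M : ℝ≥0∞) + tail x M u ω) ∂leb := by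
        refine lintegral_mono fun u => ?_
        simp only [tail]
        split_ifs with h
        · exact le_add_self
        · rw [add_zero]
          push Not at h
          have : ‖x u ω‖₊ ≤ M := by exact_mod_cast h.le
          rw [enorm_eq_nnnorm]
          exact_mod_cast this
    _ = M * leb S + ∫⁻ u in S, tail x M u ω ∂leb := by
        rw [lintegral_add_left measurable_const]
        simp

lemma tail_le (x : ℝ≥0 → Ω → EuclideanSpace ℝ (Fin d)) (M : ℝ≥0) (u : ℝ≥0) (ω : Ω) :
    tail x M u ω ≤ ‖x u ω‖ₑ := by
  simp only [tail]
  split_ifs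
  · exact le_rfl
  · exact zero_le

lemma quant {x : ℝ≥0 → Ω → EuclideanSpace ℝ (Fin d)} (hx : Measurable (Function.uncurry x))
    (N : ℕ) (T : ℕ → Ω → ℝ≥0) (hT0 : ∀ ω, T 0 ω = 0)
    (hTmono : ∀ i < N, ∀ ω, T i ω ≤ T (i + 1) ω) {δ : ℝ≥0} (hδ : δ ≤ 1)
    (hmesh : ∀ i < N, ∀ ω, T (i + 1) ω ≤ T i ω + δ) {t : ℝ≥0} (hlast : ∀ ω, t + 1 ≤ T N ω)
    {M : ℝ≥0} {ε : ℝ} (hε0 : 0 ≤ ε)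
    (hε : ∫⁻ ω, ∫⁻ u in Iic (t + 1), tail x M u ω ∂leb ∂P ≤ ENNReal.ofReal ε)
    (hfin : ∀ᵐ ω ∂P, ∀ t : ℝ≥0, ∫⁻ u in Iic t, ‖x u ω‖ₑ ∂leb < ⊤)
    (F : ℕ → MeasurableSpace Ω) (hF : Monotone F)
    (hFY : ∀ k, Measurable[F k] fun ω => ∫ u in Iic (T k ω), x u ω ∂leb)
    (hFT : ∀ k, Measurable[F k] (T k))
    (hYint : ∀ k ≤ N, Integrable (fun ω => ∫ u in Iic (T k ω), x u ω ∂leb) P)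
    (hmart : ∀ k < N, ∀ A : Set Ω, MeasurableSet[F k] A →
      ∫ ω in A, (∫ u in Iic (T (k + 1) ω), x u ω ∂leb) ∂P =
        ∫ ω in A, (∫ u in Iic (T k ω), x u ω ∂leb) ∂P) {l : ℝ} (hl : 0 < l) :
    ∫⁻ ω, (⨆ s ∈ Iic t, ‖∫ u in Iic s, x u ω ∂leb‖ₑ) ∂P ≤
      (M * δ + ENNReal.ofReal ε + d * (ENNReal.ofReal l + ENNReal.ofReal (4 * ε))) +
      M * (t + 1 : ℝ≥0) *
        (d * ENNReal.ofReal (8 * (M * δ) * (M * (t + 1) + ε) / l ^ 2)) := by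
  set L : ℝ≥0 := t + 1 with hL
  set σ : ℕ → Ω → ℝ≥0 := fun k => envN P (T k) with hσ
  have hσm : ∀ k, Measurable (σ k) := fun k => envN_measurable (T k)
  let H : Filtration ℕ m0 :=
    ⟨fun k => hullSigma P (F k), fun i j h => hullSigma_mono (hF h), fun k => hullSigma_le _⟩
  have hH : ∀ k, H k = hullSigma P (F k) := fun k => rfl
  have hσH : ∀ k, Measurable[H k] (σ k) := fun k => envN_measurable' (hFT k)
  have hxe : Measurable (Function.uncurry fun u ω => ‖x u ω‖ₑ) := hx.enorm
  have hxω : ∀ ω, Measurable fun u => x u ω := fun ω => hx.comp measurable_prodMk_right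
  have htm := tail_meas hx M
  set y : ℕ → Ω → EuclideanSpace ℝ (Fin d) := fun k ω => ∫ u in Iic (σ k ω), x u ω ∂leb with hy
  have hym : ∀ k, StronglyMeasurable (y k) := fun k => measInt hx (hσm k)
  have hyY : ∀ k ≤ N, (fun ω => ∫ u in Iic (T k ω), x u ω ∂leb) =ᵐ[P] y k := by
    intro k hk
    filter_upwards [transfer hx hfin (T k) (hYint k hk).aestronglyMeasurable] with ω h
    exact h.symm
  have hyi : ∀ k ≤ N, Integrable (y k) P := fun k hk => (hYint k hk).congr (hyY k hk)
  have hyH : ∀ k ≤ N, Measurable[H k] (y k) := fun k hk =>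
    hullSigma_measurable (hFY k) (hym k).measurable (hyY k hk)
  -- almost sure properties of the modified partition
  have h0 : ∀ ω, σ 0 ω = 0 := fun ω => by
    have := envN_le (P := P) (T 0) ω
    rw [hT0] at this
    exact le_antisymm this zero_le
  have hmono : ∀ᵐ ω ∂P, ∀ k < N, σ k ω ≤ σ (k + 1) ω := by
    refine ae_all_iff.2 fun k => ?_
    by_cases hk : k < N
    · filter_upwards [le_envN (T (k + 1)) (hσm k) (Eventually.of_forall fun ω =>
        (envN_le (P := P) (T k) ω).trans (hTmono k hk ω))] with ω h _ using h
    · exact Eventually.of_forall fun ω h => absurd h hk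
  have hstep : ∀ᵐ ω ∂P, ∀ k < N, σ (k + 1) ω ≤ σ k ω + δ := by
    refine ae_all_iff.2 fun k => ?_
    by_cases hk : k < N
    · filter_upwards [le_envN (T k) ((hσm (k + 1)).sub_const δ) (Eventually.of_forall fun ω =>
        tsub_le_iff_right.2
          ((envN_le (P := P) (T (k + 1)) ω).trans (hmesh k hk ω)))] with ω h _
      exact tsub_le_iff_right.1 h
    · exact Eventually.of_forall fun ω h => absurd h hk
  have hend : ∀ᵐ ω ∂P, L ≤ σ N ω :=
    le_envN (T N) measurable_const (Eventually.of_forall hlast)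
  -- the tails
  set W : Ω → ℝ≥0∞ := fun ω => ∫⁻ u in Iic L, tail x M u ω ∂leb with hW
  have hWm : Measurable W := measLinIic htm measurable_const
  set p : ℕ → Ω → ℝ≥0 := fun k ω => min (σ k ω) L with hp
  have hpm : ∀ k, Measurable (p k) := fun k => (hσm k).min measurable_const
  set wE : ℕ → Ω → ℝ≥0∞ := fun k ω => ∫⁻ u in Ioc (p k ω) (p (k + 1) ω), tail x M u ω ∂leb
    with hwE
  have hwEm : ∀ k, Measurable (wE k) := fun k => measLin htm (hpm k) (hpm (k + 1))
  have hwEW : ∀ k ω, wE k ω ≤ W ω := fun k ω =>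
    lintegral_mono_set (Ioc_subset_Iic_self.trans (Iic_subset_Iic.2 (min_le_right _ _)))
  set v : ℕ → Ω → ℝ≥0∞ := fun k ω => ∫⁻ u in Ioc (p k ω) (p (k + 1) ω), ‖x u ω‖ₑ ∂leb
    with hv
  have hvm : ∀ k, Measurable (v k) := fun k => measLin hxe (hpm k) (hpm (k + 1))
  have hJ : ∀ ω, ∫⁻ u in Iic L, ‖x u ω‖ₑ ∂leb ≤ M * L + W ω := by
    intro ω
    have := tail_bound x M ω (Iic L)
    rwa [leb_Iic] at this
  have hsumw : ∑ k ∈ Finset.range N, ∫⁻ ω, wE k ω ∂P ≤ ENNReal.ofReal ε := by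
    rw [← lintegral_finsetSum _ fun k _ => hwEm k]
    refine le_trans (lintegral_mono_ae ?_) hε
    filter_upwards [hmono] with ω h1
    refine (telescope (fun u => tail x M u ω) (fun k => p k ω) N fun k hk =>
      min_le_min_right _ (h1 k hk)).trans ?_
    exact lintegral_mono_set (Iic_subset_Iic.2 (min_le_right _ _))
  have hK0 : 0 ≤ (M : ℝ) * (t + 1) + ε := by positivity
  have hsumv : ∑ k ∈ Finset.range N, ∫⁻ ω, v k ω ∂P ≤ ENNReal.ofReal (M * (t + 1) + ε) := by
    rw [← lintegral_finsetSum _ fun k _ => hvm k]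
    calc ∫⁻ ω, ∑ k ∈ Finset.range N, v k ω ∂P ≤ ∫⁻ ω, ((M * L : ℝ≥0∞) + W ω) ∂P := by
          refine lintegral_mono_ae ?_
          filter_upwards [hmono] with ω h1
          refine (telescope (fun u => ‖x u ω‖ₑ) (fun k => p k ω) N fun k hk =>
            min_le_min_right _ (h1 k hk)).trans ?_
          exact (lintegral_mono_set (Iic_subset_Iic.2 (min_le_right _ _))).trans (hJ ω)
      _ = M * L + ∫⁻ ω, W ω ∂P := by
          rw [lintegral_add_left measurable_const]
          simp
      _ ≤ M * L + ENNReal.ofReal ε := by gcongr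
      _ = ENNReal.ofReal (M * (t + 1) + ε) := by
          rw [ENNReal.ofReal_add (by positivity) hε0]
          congr 1
          have : (M : ℝ) * (t + 1) = ((M * L : ℝ≥0) : ℝ) := by simp [hL]
          rw [this, ENNReal.ofReal_coe_nnreal]
          simp
  have hWfin : ∫⁻ ω, W ω ∂P ≠ ⊤ := ne_top_of_le_ne_top ENNReal.ofReal_ne_top hε
  have hwEfin : ∀ k, ∫⁻ ω, wE k ω ∂P ≠ ⊤ := fun k =>
    ne_top_of_le_ne_top hWfin (lintegral_mono (hwEW k))
  set w : ℕ → Ω → ℝ := fun k ω => (wE k ω).toReal with hw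
  have hwi : ∀ k, Integrable (w k) P := fun k =>
    integrable_toReal_of_lintegral_ne_top (hwEm k).aemeasurable (hwEfin k)
  have hwint : ∀ k, ∫ ω, w k ω ∂P = (∫⁻ ω, wE k ω ∂P).toReal := fun k =>
    integral_toReal (hwEm k).aemeasurable (ae_lt_top (hwEm k) (hwEfin k))
  -- increments
  have hinc : ∀ᵐ ω ∂P, ∀ k < N, σ k ω ≤ t →
      ‖y (k + 1) ω - y k ω‖ₑ ≤ v k ω ∧ v k ω ≤ (M * δ : ℝ≥0) + wE k ω ∧ wE k ω ≠ ⊤ := by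
    filter_upwards [hmono, hstep, hfin] with ω h1 h2 h3 k hk hkt
    have e2 : σ (k + 1) ω ≤ L := (h2 k hk).trans (add_le_add hkt hδ)
    have e1 : σ k ω ≤ L := (h1 k hk).trans e2
    have hpk : p k ω = σ k ω := min_eq_left e1
    have hpk' : p (k + 1) ω = σ (k + 1) ω := min_eq_left e2
    refine ⟨?_, ?_, ?_⟩
    · simp only [hv, hpk, hpk']
      exact incr_le (hxω ω) (h1 k hk) (h3 _)
    · simp only [hv, hwE, hpk, hpk']
      refine (tail_bound x M ω _).trans ?_
      gcongr
      rw [leb_Ioc, ENNReal.coe_mul]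
      gcongr
      exact tsub_le_iff_left.2 (h2 k hk)
    · refine ne_top_of_le_ne_top (h3 L).ne ((hwEW k ω).trans ?_)
      exact lintegral_mono fun u => tail_le x M u ω
  set D : Fin d → ℕ → Ω → ℝ := fun i k ω =>
    if k < N then {ω | σ k ω ≤ t}.indicator (fun ω => (y (k + 1) ω - y k ω) i) ω else 0 with hD
  have hci : ∀ (i : Fin d) (z : EuclideanSpace ℝ (Fin d)), ‖z i‖ₑ ≤ ‖z‖ₑ := by
    intro i z
    rw [enorm_eq_nnnorm, enorm_eq_nnnorm]
    exact_mod_cast PiLp.norm_apply_le z i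
  have hset : ∀ k, MeasurableSet[H k] {ω | σ k ω ≤ t} := fun k =>
    (hσH k) (measurableSet_Iic : MeasurableSet (Iic t))
  have hev : ∀ i : Fin d, Measurable fun z : EuclideanSpace ℝ (Fin d) => z i := fun i =>
    (EuclideanSpace.proj (𝕜 := ℝ) i).continuous.measurable
  have hΔi : ∀ k < N, Integrable (fun ω => y (k + 1) ω - y k ω) P := fun k hk =>
    (hyi (k + 1) hk).sub (hyi k hk.le)
  have hDm : ∀ i k, StronglyMeasurable[H (k + 1)] (D i k) := by
    intro i k
    by_cases hk : k < N
    · simp only [hD, if_pos hk]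
      have hle : H k ≤ H (k + 1) := H.mono (Nat.le_succ k)
      have h1 : Measurable[H (k + 1)] (y (k + 1)) := hyH (k + 1) hk
      have h2 : Measurable[H (k + 1)] (y k) := (hyH k hk.le).mono hle le_rfl
      have h3 : Measurable[H (k + 1)] fun ω => (y (k + 1) ω - y k ω) i :=
        (hev i).comp (h1.sub h2)
      exact (h3.indicator (hle _ (hset k))).stronglyMeasurable
    · simp only [hD, if_neg hk]
      exact stronglyMeasurable_const
  have hDi : ∀ i k, Integrable (D i k) P := by
    intro i k
    by_cases hk : k < N
    · simp only [hD, if_pos hk]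
      refine Integrable.indicator ?_ (H.le k _ (hset k))
      exact (EuclideanSpace.proj (𝕜 := ℝ) i).integrable_comp (hΔi k hk)
    · simp only [hD, if_neg hk]
      exact integrable_zero _ _ _
  have hzero : ∀ k < N, ∀ A, MeasurableSet[H k] A → ∫ ω in A, (y (k + 1) ω - y k ω) ∂P = 0 := by
    intro k hk A hA
    refine hullSigma_integral (hΔi k hk) (F := F k) ?_ A hA
    intro A hA
    rw [integral_sub (hyi (k + 1) hk).restrict (hyi k hk.le).restrict,
      ← integral_congr_ae (ae_restrict_of_ae (hyY (k + 1) hk)),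
      ← integral_congr_ae (ae_restrict_of_ae (hyY k hk.le)), hmart k hk A hA, sub_self]
  have hD0 : ∀ i k, P[D i k | H k] =ᵐ[P] 0 := by
    intro i k
    refine (ae_eq_condExp_of_forall_setIntegral_eq (H.le k) (hDi i k)
      (fun _ _ _ => integrableOn_zero) ?_ aestronglyMeasurable_zero).symm
    intro A hA _
    by_cases hk : k < N
    · simp only [hD, if_pos hk]
      rw [setIntegral_indicator (H.le k _ (hset k))]
      have := (EuclideanSpace.proj (𝕜 := ℝ) i).integral_comp_comm
        (hΔi k hk).restrict (μ := P.restrict (A ∩ {ω | σ k ω ≤ t}))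
      rw [hzero k hk _ (MeasurableSet.inter hA (hset k))] at this
      simpa using this.symm
    · simp [hD, if_neg hk]
  have hDv : ∀ i, ∀ᵐ ω ∂P, ∀ k, ‖D i k ω‖ₑ ≤ v k ω := by
    intro i
    filter_upwards [hinc] with ω h k
    simp only [hD]
    split_ifs with hk
    · by_cases hkt : σ k ω ≤ t
      · rw [indicator_of_mem (show ω ∈ {ω | σ k ω ≤ t} from hkt)]
        exact (hci i _).trans (h k hk hkt).1
      · rw [indicator_of_notMem (show ω ∉ {ω | σ k ω ≤ t} from hkt)]
        simp
    · simp
  have hDb : ∀ i k, ∀ᵐ ω ∂P, |D i k ω| ≤ ((M * δ : ℝ≥0) : ℝ) + w k ω := by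
    intro i k
    filter_upwards [hinc] with ω h
    simp only [hD]
    split_ifs with hk
    · by_cases hkt : σ k ω ≤ t
      · rw [indicator_of_mem (show ω ∈ {ω | σ k ω ≤ t} from hkt)]
        obtain ⟨g1, g2, g3⟩ := h k hk hkt
        have g4 := ((hci i _).trans g1).trans g2
        have g5 := ENNReal.toReal_mono (ENNReal.add_ne_top.2 ⟨ENNReal.coe_ne_top, g3⟩) g4
        rw [ENNReal.toReal_add ENNReal.coe_ne_top g3] at g5
        simpa [Real.norm_eq_abs] using g5
      · rw [indicator_of_notMem (show ω ∉ {ω | σ k ω ≤ t} from hkt)]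
        simp only [abs_zero]
        positivity
    · simp only [abs_zero]
      positivity
  have hcore : ∀ i, ∃ (B : Set Ω) (Q : Ω → ℝ≥0∞), MeasurableSet B ∧ Measurable Q ∧
      P B ≤ ENNReal.ofReal (8 * (M * δ : ℝ≥0) * (M * (t + 1) + ε) / l ^ 2) ∧
      ∫⁻ ω, Q ω ∂P ≤ ENNReal.ofReal (4 * ε) ∧
      ∀ᵐ ω ∂P, ω ∉ B → ∀ j ≤ N,
        ‖∑ k ∈ Finset.range j, D i k ω‖ₑ ≤ ENNReal.ofReal l + Q ω := by
    intro i
    refine core H (D i) (hDm i) (hDi i) (hD0 i) w hwi (fun k ω => ENNReal.toReal_nonneg)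
      (NNReal.coe_nonneg _) (hDb i) N ?_ ?_ hl
    · simp_rw [hwint]
      exact sum_toReal_le _ N hε0 hsumw
    · have : ∀ k, ∫ ω, |D i k ω| ∂P = (∫⁻ ω, ‖D i k ω‖ₑ ∂P).toReal := fun k =>
        integral_norm_eq_lintegral_enorm (hDi i k).aestronglyMeasurable
      simp_rw [this]
      refine sum_toReal_le _ N hK0 (le_trans (Finset.sum_le_sum fun k _ => ?_) hsumv)
      refine lintegral_mono_ae ?_
      filter_upwards [hDv i] with ω h using h k
  choose B Q hBm hQm hPB hPQ hBQ using hcore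
  have hsup : ∀ᵐ ω ∂P, (⨆ s ∈ Iic t, ‖∫ u in Iic s, x u ω ∂leb‖ₑ) ≤
      ((M * δ : ℝ≥0) + W ω + ∑ i, (ENNReal.ofReal l + Q i ω)) +
        (⋃ i, B i).indicator (fun _ => ((M * L : ℝ≥0) : ℝ≥0∞)) ω := by
    filter_upwards [hmono, hstep, hend, hfin, ae_all_iff.2 hBQ] with ω h1 h2 h3 h4 h5
    refine iSup₂_le fun s hs => ?_
    have hs : s ≤ t := hs
    have hsL : s ≤ L := hs.trans (by simp [hL])
    by_cases hB : ω ∈ ⋃ i, B i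
    · rw [indicator_of_mem hB]
      calc ‖∫ u in Iic s, x u ω ∂leb‖ₑ ≤ ∫⁻ u in Iic s, ‖x u ω‖ₑ ∂leb :=
            enorm_integral_le_lintegral_enorm _
        _ ≤ ∫⁻ u in Iic L, ‖x u ω‖ₑ ∂leb := lintegral_mono_set (Iic_subset_Iic.2 hsL)
        _ ≤ M * L + W ω := hJ ω
        _ = W ω + (M * L : ℝ≥0) := by rw [add_comm, ENNReal.coe_mul]
        _ ≤ _ := by
            gcongr
            exact le_add_right le_add_self
    · rw [indicator_of_notMem hB, add_zero]
      have hB' : ∀ i, ω ∉ B i := fun i hi => hB (mem_iUnion.2 ⟨i, hi⟩)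
      have hex : ∃ k, s < σ k ω := ⟨N, lt_of_lt_of_le (lt_of_le_of_lt hs (by simp [hL])) h3⟩
      classical
      have hfs := Nat.find_spec hex
      have hfm : ∀ j < Nat.find hex, σ j ω ≤ s := fun j hj => not_lt.1 (Nat.find_min hex hj)
      have hfN : Nat.find hex ≤ N :=
        Nat.find_min' hex (lt_of_lt_of_le (lt_of_le_of_lt hs (by simp [hL])) h3)
      obtain ⟨n, hn⟩ : ∃ n, Nat.find hex = n + 1 := by
        refine Nat.exists_eq_succ_of_ne_zero fun h => ?_
        rw [h, h0] at hfs
        exact absurd hfs not_lt_zero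
      rw [hn] at hfs hfm hfN
      have hns : σ n ω ≤ s := hfm n (Nat.lt_succ_self n)
      have hsum : ∀ i, ∑ k ∈ Finset.range n, D i k ω = y n ω i := by
        intro i
        have e1 : ∀ k ∈ Finset.range n, D i k ω = y (k + 1) ω i - y k ω i := by
          intro k hk
          have hk' : k < n := by simpa using hk
          have hkt : σ k ω ≤ t := (hfm k (by omega)).trans hs
          simp only [hD]
          rw [if_pos (by omega), indicator_of_mem (show ω ∈ {ω | σ k ω ≤ t} from hkt)]
          simp
        rw [Finset.sum_congr rfl e1, Finset.sum_range_sub (fun k => y k ω i)]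
        have e2 : y 0 ω = 0 := by
          simp only [hy, h0]
          rw [Measure.restrict_eq_zero.2 (by rw [leb_Iic]; simp)]
          simp
        simp [e2]
      have hyn : ‖y n ω‖ₑ ≤ ∑ i, (ENNReal.ofReal l + Q i ω) := by
        refine (enorm_le_sum _).trans (Finset.sum_le_sum fun i _ => ?_)
        rw [← hsum i]
        exact h5 i (hB' i) n (by omega)
      have hd : ‖(∫ u in Iic s, x u ω ∂leb) - y n ω‖ₑ ≤ (M * δ : ℝ≥0) + W ω := by
        refine (incr_le (hxω ω) hns (h4 _)).trans ((tail_bound x M ω _).trans ?_)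
        rw [leb_Ioc, ENNReal.coe_mul]
        gcongr
        · exact tsub_le_iff_left.2 (hfs.le.trans (h2 n (by omega)))
        · exact lintegral_mono_set (Ioc_subset_Iic_self.trans (Iic_subset_Iic.2 hsL))
      calc ‖∫ u in Iic s, x u ω ∂leb‖ₑ
          = ‖((∫ u in Iic s, x u ω ∂leb) - y n ω) + y n ω‖ₑ := by rw [sub_add_cancel]
        _ ≤ ‖(∫ u in Iic s, x u ω ∂leb) - y n ω‖ₑ + ‖y n ω‖ₑ := enorm_add_le _ _
        _ ≤ _ := add_le_add hd hyn
  refine (lintegral_mono_ae hsup).trans ?_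
  have hUm : MeasurableSet (⋃ i, B i) := MeasurableSet.iUnion hBm
  rw [lintegral_add_right _ (measurable_const.indicator hUm),
    lintegral_add_left (hWm.const_add _), lintegral_add_left measurable_const,
    lintegral_finsetSum _ fun i _ => (hQm i).const_add _, lintegral_indicator_const hUm]
  gcongr ?_ + ?_ + ?_ + ?_ * ?_
  · simp
  · calc ∑ i, ∫⁻ ω, (ENNReal.ofReal l + Q i ω) ∂P
        ≤ ∑ i : Fin d, (ENNReal.ofReal l + ENNReal.ofReal (4 * ε)) := by
          refine Finset.sum_le_sum fun i _ => ?_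
          rw [lintegral_add_left measurable_const]
          gcongr
          · simp
          · exact hPQ i
      _ = _ := by rw [Finset.sum_const, Finset.card_univ, Fintype.card_fin, nsmul_eq_mul]
  · simp
  · refine (measure_iUnion_fintype_le P B).trans ((Finset.sum_le_sum fun i _ => hPB i).trans ?_)
    simp

end Quant

lemma rhs_small {d : ℕ} {M t : ℝ≥0} {ε : ℝ} (hε : 0 < ε) {η : ℝ≥0}
    (h : ε + d * (ε + 4 * ε) < η) :
    ∃ δ : ℝ≥0, 0 < δ ∧ δ ≤ 1 ∧
      (M * δ + ENNReal.ofReal ε + d * (ENNReal.ofReal ε + ENNReal.ofReal (4 * ε))) +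
      M * (t + 1 : ℝ≥0) *
        (d * ENNReal.ofReal (8 * (M * δ) * (M * (t + 1) + ε) / ε ^ 2)) ≤ (η : ℝ≥0∞) := by
  have hc : Continuous fun δ : ℝ≥0 => (M * δ + ε + d * (ε + 4 * ε)) +
      M * (t + 1) * (d * (8 * (M * δ) * (M * (t + 1) + ε) / ε ^ 2) : ℝ) := by fun_prop
  have hev : ∀ᶠ δ : ℝ≥0 in 𝓝 0, (M * δ + ε + d * (ε + 4 * ε)) +
      M * (t + 1) * (d * (8 * (M * δ) * (M * (t + 1) + ε) / ε ^ 2) : ℝ) < η :=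
    hc.continuousAt.eventually_lt continuousAt_const (by simpa using h)
  have hev1 : ∀ᶠ δ : ℝ≥0 in 𝓝 0, δ ≤ 1 := Iic_mem_nhds one_pos
  have hev2 : ∀ᶠ δ : ℝ≥0 in 𝓝[>] 0, 0 < δ := self_mem_nhdsWithin
  obtain ⟨δ, ⟨h1, h2⟩, h3⟩ := (((hev.and hev1).filter_mono nhdsWithin_le_nhds).and hev2).exists
  refine ⟨δ, h3, h2, ?_⟩
  have e := ENNReal.ofReal_le_ofReal h1.le
  rw [ENNReal.ofReal_coe_nnreal] at e
  refine le_trans (le_of_eq ?_) e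
  have a1 : (M : ℝ≥0∞) = ENNReal.ofReal M := (ENNReal.ofReal_coe_nnreal).symm
  have a2 : (δ : ℝ≥0∞) = ENNReal.ofReal δ := (ENNReal.ofReal_coe_nnreal).symm
  have a3 : ((t + 1 : ℝ≥0) : ℝ≥0∞) = ENNReal.ofReal (t + 1) := by
    rw [← ENNReal.ofReal_coe_nnreal]; simp
  have a4 : (d : ℝ≥0∞) = ENNReal.ofReal d := (ENNReal.ofReal_natCast d).symm
  rw [a1, a2, a4]
  rw [ENNReal.ofReal_add (by positivity) (by positivity),
    ENNReal.ofReal_add (by positivity) (by positivity),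
    ENNReal.ofReal_add (by positivity) (by positivity),
    ENNReal.ofReal_mul (p := (M : ℝ)) (q := (δ : ℝ)) (by positivity),
    ENNReal.ofReal_mul (p := (d : ℝ)) (by positivity),
    ENNReal.ofReal_add (by positivity) (by positivity),
    ENNReal.ofReal_mul (p := (M : ℝ) * (t + 1)) (by positivity),
    ENNReal.ofReal_mul (p := (M : ℝ)) (q := (t : ℝ) + 1) (by positivity), a3,
    ENNReal.ofReal_mul (p := (d : ℝ)) (by positivity)]

lemma sup_comap_meas {Ω A : Type*} [mA : MeasurableSpace A] (f : ℕ → Ω → A) (k : ℕ) :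
    Measurable[⨆ j ∈ Finset.range (k + 1), MeasurableSpace.comap (f j) mA] (f k) := by
  have h : MeasurableSpace.comap (f k) mA ≤
      ⨆ j ∈ Finset.range (k + 1), MeasurableSpace.comap (f j) mA :=
    le_iSup₂ (f := fun j (_ : j ∈ Finset.range (k + 1)) => MeasurableSpace.comap (f j) mA) k
      (Finset.self_mem_range_succ k)
  intro s hs
  exact h _ ⟨s, hs, rfl⟩

/-- **Proposition.** Let `(Ω^m, F^m, P^m)` be probability spaces carrying
`ℝ^d`-valued processes `X^m` and random partitions `Π^m` converging uniformly
to the identity, such that `(X^m, λ_{[0,t]} × P^m)_m` is uniformly integrable.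
If `Y_k^m := ∫_0^{T_k^m} X_u^m du` is a martingale in `k` with respect to
`F_k^m := σ(Y_j^m, T_j^m : j ≤ k)` for each `m`, then
`E^m sup_{0≤s≤t} ‖∫_0^s X_u^m du‖ → 0` for every `t ≥ 0`. -/
theorem discrete_martingale_integral_to_zero
    {d : ℕ} (hd : 0 < d)
    {Ωm : ℕ → Type} [∀ m, MeasurableSpace (Ωm m)]
    (P : ∀ m, Measure (Ωm m)) [∀ m, IsProbabilityMeasure (P m)]
    (X : ∀ m, ℝ≥0 → Ωm m → EuclideanSpace ℝ (Fin d))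
    (hX : ∀ m, Measurable (Function.uncurry (X m)))
    -- the random partitions `Π^m = {0 = T_0^m ≤ T_1^m ≤ ⋯ ≤ T_{N(m)}^m}`
    (N : ℕ → ℕ) (T : ∀ m, ℕ → Ωm m → ℝ≥0)
    (hT0 : ∀ m ω, T m 0 ω = 0)
    (hTmono : ∀ m i, i < N m → ∀ ω, T m i ω ≤ T m (i + 1) ω)
    -- the partitions converge uniformly to the identity
    (hmesh : Tendsto (fun m =>
        ⨆ ω : Ωm m, ⨆ i ∈ Finset.Icc 1 (N m),
          ((T m i ω - T m (i - 1) ω : ℝ≥0) : ℝ≥0∞))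
      atTop (𝓝 0))
    (hlast : Tendsto (fun m => ⨅ ω : Ωm m, ((T m (N m) ω : ℝ≥0∞)))
      atTop (𝓝 ⊤))
    -- `(X^m, λ_{[0,t]} × P^m)_m` is uniformly integrable for every `t ≥ 0`
    (hui : ∀ t : ℝ≥0, ∀ ε : ℝ, 0 < ε → ∃ M : ℝ, ∀ m,
      ∫⁻ ω, (∫⁻ u in Set.Iic t,
          (if M ≤ ‖X m u ω‖ then (‖X m u ω‖₊ : ℝ≥0∞) else 0) ∂leb) ∂(P m)
        ≤ ENNReal.ofReal ε)
    -- `(Y_k^m, F_k^m)_{0 ≤ k ≤ N(m)}` is a martingale for each `m`,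
    -- where `Y_k^m = ∫_0^{T_k^m} X_u^m du` and `F_k^m = σ(Y_j^m, T_j^m : j ≤ k)`
    (hYint : ∀ m, ∀ k ≤ N m,
      Integrable (fun ω => ∫ u in Set.Iic (T m k ω), X m u ω ∂leb) (P m))
    (hmart : ∀ m, ∀ k, k < N m → ∀ A : Set (Ωm m),
      MeasurableSet[⨆ j ∈ Finset.range (k + 1),
        MeasurableSpace.comap
          (fun ω => ((∫ u in Set.Iic (T m j ω), X m u ω ∂leb : EuclideanSpace ℝ (Fin d)),
            T m j ω))
          inferInstance] A →
      ∫ ω in A, (∫ u in Set.Iic (T m (k + 1) ω), X m u ω ∂leb) ∂(P m) =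
        ∫ ω in A, (∫ u in Set.Iic (T m k ω), X m u ω ∂leb) ∂(P m)) :
    ∀ t : ℝ≥0,
      Tendsto (fun m =>
          ∫⁻ ω, (⨆ s ∈ Set.Iic t,
            (‖(∫ u in Set.Iic s, X m u ω ∂leb : EuclideanSpace ℝ (Fin d))‖₊ : ℝ≥0∞))
            ∂(P m))
        atTop (𝓝 0) := by
  intro t
  -- uniform integrability in terms of `tail`
  have hui' : ∀ t : ℝ≥0, ∀ ε : ℝ, 0 < ε → ∃ M : ℝ≥0, ∀ m,
      ∫⁻ ω, ∫⁻ u in Iic t, tail (X m) M u ω ∂leb ∂(P m) ≤ ENNReal.ofReal ε := by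
    intro t ε hε
    obtain ⟨M, hM⟩ := hui t ε hε
    refine ⟨M.toNNReal, fun m => le_trans ?_ (hM m)⟩
    refine lintegral_mono fun ω => lintegral_mono fun u => ?_
    simp only [tail]
    split_ifs with h1 h2 h2
    · exact le_rfl
    · exact absurd ((Real.le_coe_toNNReal M).trans h1) h2
    · exact zero_le
    · exact le_rfl
  have hfin : ∀ m, ∀ᵐ ω ∂(P m), ∀ t : ℝ≥0, ∫⁻ u in Iic t, ‖X m u ω‖ₑ ∂leb < ⊤ := by
    intro m
    have h1 : ∀ᵐ ω ∂(P m), ∀ n : ℕ, ∫⁻ u in Iic (n : ℝ≥0), ‖X m u ω‖ₑ ∂leb < ⊤ := by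
      refine ae_all_iff.2 fun n => ?_
      obtain ⟨M, hM⟩ := hui' n 1 one_pos
      filter_upwards [ae_lt_top (measLinIic (tail_meas (hX m) M) measurable_const)
        (ne_top_of_le_ne_top ENNReal.ofReal_ne_top (hM m))] with ω hω
      refine (tail_bound (X m) M ω _).trans_lt ?_
      rw [leb_Iic]
      exact ENNReal.add_lt_top.2 ⟨ENNReal.mul_lt_top ENNReal.coe_lt_top ENNReal.coe_lt_top, hω⟩
    filter_upwards [h1] with ω hω t
    obtain ⟨n, hn⟩ := exists_nat_ge t
    exact (lintegral_mono_set (Iic_subset_Iic.2 hn)).trans_lt (hω n)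
  rw [ENNReal.tendsto_nhds_zero]
  intro η0 hη0
  obtain ⟨η, hη, hηη⟩ := ENNReal.lt_iff_exists_nnreal_btwn.1 hη0
  have hη : (0 : ℝ) < η := by exact_mod_cast hη
  obtain ⟨ε, hε, hεη⟩ : ∃ ε : ℝ, 0 < ε ∧ ε + d * (ε + 4 * ε) < η := by
    have hd' : (0 : ℝ) < 1 + 5 * d := by positivity
    refine ⟨η / (2 * (1 + 5 * d)), by positivity, ?_⟩
    have : (η : ℝ) / (2 * (1 + 5 * d)) + d * (η / (2 * (1 + 5 * d)) +
        4 * (η / (2 * (1 + 5 * d)))) = η / 2 := by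
      field_simp
      ring
    rw [this]
    linarith
  obtain ⟨M, hM⟩ := hui' (t + 1) ε hε
  obtain ⟨δ, hδ0, hδ1, hδ⟩ := rhs_small (M := M) (t := t) hε hεη
  have ev1 := (ENNReal.tendsto_nhds_zero.1 hmesh) δ (by exact_mod_cast hδ0)
  have ev2 := (ENNReal.tendsto_nhds_top_iff_nnreal.1 hlast) (t + 1)
  filter_upwards [ev1, ev2] with m h1 h2
  refine le_trans ?_ (hδ.trans hηη.le)
  refine quant (hX m) (N m) (T m) (hT0 m) (hTmono m) hδ1 ?_ ?_ hε.le (hM m) (hfin m)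
    (fun k => ⨆ j ∈ Finset.range (k + 1),
        MeasurableSpace.comap
          (fun ω => ((∫ u in Set.Iic (T m j ω), X m u ω ∂leb : EuclideanSpace ℝ (Fin d)),
            T m j ω))
          inferInstance) ?_ ?_ ?_ (hYint m) (hmart m) hε
  · intro i hi ω
    have h3 := (le_iSup₂_of_le (f := fun i (_ : i ∈ Finset.Icc 1 (N m)) =>
      ((T m i ω - T m (i - 1) ω : ℝ≥0) : ℝ≥0∞)) (i + 1)
      (Finset.mem_Icc.2 ⟨by omega, by omega⟩) le_rfl).trans ((le_iSup _ ω).trans h1)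
    have h4 : T m (i + 1) ω - T m (i + 1 - 1) ω ≤ δ := by exact_mod_cast h3
    rw [Nat.add_sub_cancel] at h4
    exact tsub_le_iff_left.1 h4
  · intro ω
    have h3 := h2.le.trans (iInf_le _ ω)
    exact_mod_cast h3
  · intro a b hab
    refine biSup_mono fun j hj => ?_
    rw [Finset.mem_range] at hj ⊢
    omega
  · intro k
    exact measurable_fst.comp (sup_comap_meas (fun j ω =>
      ((∫ u in Set.Iic (T m j ω), X m u ω ∂leb : EuclideanSpace ℝ (Fin d)), T m j ω)) k)
  · intro k
    exact measurable_snd.comp (sup_comap_meas (fun j ω =>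
      ((∫ u in Set.Iic (T m j ω), X m u ω ∂leb : EuclideanSpace ℝ (Fin d)), T m j ω)) k)

end Mimic
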